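/- Let λ₁, λ₂, λ₃ ∈ ℝ, let [·,·] be the Table 1 bracket on ℝ⁶, g the Norden metric, J the almost complex structure with Jeᵢ = e_{i+3}, Je_{i+3} = −eᵢ for i = 1,2,3, and F(x,y,z) := (1/2)·(g([x, J y], z) − g([x,y], J z)). Let εᵢ := g(eᵢ,eᵢ) (so εᵢ = 1 for i = 1,2,3 and εᵢ = −1 for i = 4,5,6). Then the square norm of ∇J vanishes: ‖∇J‖ = Σ_{i,k,p=1}^{6} εᵢ·εₖ·ε_p·F(eᵢ,eₖ,e_p)² = 0; i.e. the manifold (G,J,g) is isotropic Kählerian. -/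

import Mathlib

noncomputable section

open Finset

/-- Component `k` of the Table 1 bracket `[e_i, e_j]` (indices 0–5 for e₁–e₆). -/
def tbl (l1 l2 l3 : ℝ) : Fin 6 → Fin 6 → Fin 6 → ℝ :=
  let v12 : Fin 6 → ℝ := ![0, 0, 0, l2, l3, 0]
  let v13 : Fin 6 → ℝ := ![0, 0, 0, -l1, 0, -l3]
  let v14 : Fin 6 → ℝ := ![0, l2, -l1, 0, l2, -l1]
  let v15 : Fin 6 → ℝ := ![0, l3, 0, -l2, 0, 0]
  let v16 : Fin 6 → ℝ := ![0, 0, -l3, l1, 0, 0]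
  let v23 : Fin 6 → ℝ := ![0, 0, 0, 0, l1, l2]
  let v24 : Fin 6 → ℝ := ![-l2, 0, 0, 0, l3, 0]
  let v25 : Fin 6 → ℝ := ![-l3, 0, l1, -l3, 0, l1]
  let v26 : Fin 6 → ℝ := ![0, 0, l2, 0, -l1, 0]
  let v34 : Fin 6 → ℝ := ![l1, 0, 0, 0, 0, -l3]
  let v35 : Fin 6 → ℝ := ![0, -l1, 0, 0, 0, l2]
  let v36 : Fin 6 → ℝ := ![l3, -l2, 0, l3, -l2, 0]
  let v45 : Fin 6 → ℝ := ![-l2, -l3, 0, 0, 0, 0]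
  let v46 : Fin 6 → ℝ := ![l1, 0, l3, 0, 0, 0]
  let v56 : Fin 6 → ℝ := ![0, -l1, -l2, 0, 0, 0]
  ![![0, v12, v13, v14, v15, v16],
    ![-v12, 0, v23, v24, v25, v26],
    ![-v13, -v23, 0, v34, v35, v36],
    ![-v14, -v24, -v34, 0, v45, v46],
    ![-v15, -v25, -v35, -v45, 0, v56],
    ![-v16, -v26, -v36, -v46, -v56, 0]]

/-- The Table 1 bracket on ℝ⁶, extended bilinearly. -/
def br (l1 l2 l3 : ℝ) (x y : Fin 6 → ℝ) : Fin 6 → ℝ :=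
  fun k => ∑ i : Fin 6, ∑ j : Fin 6, x i * y j * tbl l1 l2 l3 i j k

/-- The standard basis of ℝ⁶. -/
def e (i : Fin 6) : Fin 6 → ℝ := Pi.single i 1

/-- The signs of the Norden metric. -/
def eps : Fin 6 → ℝ := ![1, 1, 1, -1, -1, -1]

/-- The Norden metric: diagonal with entries (1,1,1,-1,-1,-1). -/
def gN (x y : Fin 6 → ℝ) : ℝ := ∑ i : Fin 6, eps i * x i * y i

/-- The almost complex structure: J eᵢ = e_{i+3}, J e_{i+3} = −eᵢ (i = 1,2,3). -/
def JN (x : Fin 6 → ℝ) : Fin 6 → ℝ := ![-x 3, -x 4, -x 5, x 0, x 1, x 2]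

/-- The fundamental tensor F(x,y,z) = g((∇ₓJ)y, z) with ∇ₓy = (1/2)[x,y]. -/
def FT (l1 l2 l3 : ℝ) (x y z : Fin 6 → ℝ) : ℝ :=
  (1/2 : ℝ) * (gN (br l1 l2 l3 x (JN y)) z - gN (br l1 l2 l3 x y) (JN z))

/-- The (0,4)-curvature tensor R(x,y,z,u) = −(1/4)g([x,y],[z,u]). -/
def RT (l1 l2 l3 : ℝ) (x y z u : Fin 6 → ℝ) : ℝ :=
  -(1/4 : ℝ) * gN (br l1 l2 l3 x y) (br l1 l2 l3 z u)

/-- The Ricci tensor ρ(y,z) = Σᵢ εᵢ R(eᵢ,y,z,eᵢ). -/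
def ricT (l1 l2 l3 : ℝ) (y z : Fin 6 → ℝ) : ℝ :=
  ∑ i : Fin 6, eps i * RT l1 l2 l3 (e i) y z (e i)

/-- The sectional curvature of the plane spanned by x, y. -/
def kT (l1 l2 l3 : ℝ) (x y : Fin 6 → ℝ) : ℝ :=
  RT l1 l2 l3 x y y x / (gN x x * gN y y - gN x y ^ 2)

/-- The matrix of ad x : v ↦ [x,v]. -/
def adM (l1 l2 l3 : ℝ) (x : Fin 6 → ℝ) : Matrix (Fin 6) (Fin 6) ℝ :=
  Matrix.of fun k j => br l1 l2 l3 x (e j) k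

/-- The Killing form B(x,y) = tr(ad x ∘ ad y). -/
def KB (l1 l2 l3 : ℝ) (x y : Fin 6 → ℝ) : ℝ :=
  Matrix.trace (adM l1 l2 l3 x * adM l1 l2 l3 y)

theorem br_e_e (l1 l2 l3 : ℝ) (i j : Fin 6) :
    br l1 l2 l3 (e i) (e j) = tbl l1 l2 l3 i j := by
  ext k
  simp [br, e, Pi.single_apply]

theorem br_smul_right (l1 l2 l3 c : ℝ) (x y : Fin 6 → ℝ) :
    br l1 l2 l3 x (c • y) = c • br l1 l2 l3 x y := by
  ext k
  simp only [br, Pi.smul_apply, smul_eq_mul, Finset.mul_sum]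
  exact Finset.sum_congr rfl fun i _ => Finset.sum_congr rfl fun j _ => by ring

theorem gN_e (x : Fin 6 → ℝ) (p : Fin 6) : gN x (e p) = eps p * x p := by
  simp [gN, e, Pi.single_apply]

theorem gN_smul_left (c : ℝ) (x y : Fin 6 → ℝ) : gN (c • x) y = c * gN x y := by
  simp only [gN, Pi.smul_apply, smul_eq_mul, Finset.mul_sum]
  exact Finset.sum_congr rfl fun i _ => by ring

theorem gN_smul_right (c : ℝ) (x y : Fin 6 → ℝ) : gN x (c • y) = c * gN x y := by
  simp only [gN, Pi.smul_apply, smul_eq_mul, Finset.mul_sum]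
  exact Finset.sum_congr rfl fun i _ => by ring

theorem JN_e (k : Fin 6) : JN (e k) = eps k • e (k + 3) := by
  ext p
  fin_cases k <;> fin_cases p <;> simp [JN, e, eps]

theorem eps_mul_eps_add_three (p : Fin 6) : eps p * eps (p + 3) = -1 := by
  fin_cases p <;> simp [eps]

/-- The components of the fundamental tensor in the standard basis. -/
theorem FT_e (l1 l2 l3 : ℝ) (i k p : Fin 6) :
    FT l1 l2 l3 (e i) (e k) (e p) =
      (1 / 2) * (eps k * eps p * tbl l1 l2 l3 i (k + 3) p + tbl l1 l2 l3 i k (p + 3)) := by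
  rw [FT, JN_e, JN_e, br_smul_right, gN_smul_left, gN_smul_right, br_e_e, br_e_e, gN_e, gN_e]
  linear_combination (-(1 / 2) * tbl l1 l2 l3 i k (p + 3)) * eps_mul_eps_add_three p

/-- Proposition 4.1: the square norm of ∇J vanishes,
‖∇J‖ = Σ εᵢεₖε_p F(eᵢ,eₖ,e_p)² = 0, i.e. the manifold is isotropic Kählerian. -/
theorem table1_isotropic_Kaehler (l1 l2 l3 : ℝ) :
    ∑ i : Fin 6, ∑ k : Fin 6, ∑ p : Fin 6,
      eps i * eps k * eps p * FT l1 l2 l3 (e i) (e k) (e p) ^ 2 = 0 := by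
  simp only [FT_e]
  simp [Fin.sum_univ_six, eps, tbl]
  ring
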